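/- arXiv:2302.09962 — 2 statements merged into one kernel-verified Lean document; each statement's English description precedes it below -/
import Mathlib

section
/- Let M ≥ 0 be a fixed real number. For r with |r| ≤ M, y > 0, t = y (i.e. θ = π/2, t = y sin(π/2)) and ν = r + iy, one has K_ν(y) ∼ exp(−(π/2) y + i (π/2) r) · y^{−1/3} · Γ(1/3) / (2^{2/3} 3^{1/6}) as y → ∞, where Γ is the gamma function. -/
open MeasureTheory Filter Topology

/-- The K-Bessel function, defined via the integral representation
`K_ν(y) = (1/2) ∫_{-∞}^{∞} exp(−y cosh R + ν R) dR`. -/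
noncomputable def KBessel (ν : ℂ) (y : ℝ) : ℂ :=
  (1 / 2) * ∫ R : ℝ, Complex.exp (-(y : ℂ) * (Real.cosh R : ℂ) + ν * (R : ℂ))

theorem norm_sub_le_of_vertical_segment {f F : ℂ → ℂ} (hF : ∀ z, HasDerivAt F (f z) z)
    {x a b C : ℝ} (hC : ∀ v ∈ Set.uIcc a b, ‖f (x + v * Complex.I)‖ ≤ C) :
    ‖F (x + b * Complex.I) - F (x + a * Complex.I)‖ ≤ C * |b - a| := by
  have hd (v : ℝ) : HasDerivAt (fun v : ℝ => F (x + v * Complex.I))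
      (f (x + v * Complex.I) * Complex.I) v := by
    have h1 : HasDerivAt (fun v : ℝ => (x : ℂ) + v * Complex.I) Complex.I v := by
      simpa using ((Complex.ofRealCLM.hasDerivAt (x := v)).mul_const Complex.I).const_add (x : ℂ)
    exact (hF _).comp v h1
  have := (convex_uIcc a b).norm_image_sub_le_of_norm_hasDerivWithin_le
    (fun v _ => (hd v).hasDerivWithinAt) (C := C) (fun v hv => by simpa using hC v hv)
    Set.left_mem_uIcc Set.right_mem_uIcc
  simpa using this

theorem intervalIntegral_along_line {f F : ℂ → ℂ} (hF : ∀ z, HasDerivAt F (f z) z)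
    (hf : Continuous f) (p d : ℂ) (a b : ℝ) :
    ∫ x in a..b, f (p + x * d) * d = F (p + b * d) - F (p + a * d) := by
  refine intervalIntegral.integral_eq_sub_of_hasDerivAt (f := fun x : ℝ => F (p + x * d))
    (fun x _ => ?_) (Continuous.intervalIntegrable (by fun_prop) _ _)
  have h1 : HasDerivAt (fun v : ℝ => p + v * d) d x := by
    simpa using ((Complex.ofRealCLM.hasDerivAt (x := x)).mul_const d).const_add p
  exact (hF _).comp x h1

theorem intervalIntegral_horizontal {f F : ℂ → ℂ} (hF : ∀ z, HasDerivAt F (f z) z)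
    (hf : Continuous f) (v a b : ℝ) :
    ∫ x in a..b, f (x + v * Complex.I) = F (b + v * Complex.I) - F (a + v * Complex.I) := by
  simpa [add_comm] using intervalIntegral_along_line hF hf (v * Complex.I) 1 a b

/-- The integral of an entire function over horizontal lines does not depend on the line, as long
as the function decays in the strip between them. -/
theorem integral_horizontal_eq {f : ℂ → ℂ} (hf : Differentiable ℂ f) {a b : ℝ} {C : ℝ → ℝ}
    (hC : ∀ x : ℝ, ∀ v ∈ Set.uIcc a b, ‖f (x + v * Complex.I)‖ ≤ C x)
    (hCi : Integrable C) (hbot : Tendsto C atBot (𝓝 0)) (htop : Tendsto C atTop (𝓝 0)) :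
    ∫ x : ℝ, f (x + a * Complex.I) = ∫ x : ℝ, f (x + b * Complex.I) := by
  obtain ⟨F, hF'⟩ := hf.isExactOn_univ
  have hF : ∀ z, HasDerivAt F (f z) z := fun z => hF' z (Set.mem_univ z)
  have hint (v : ℝ) (hv : v ∈ Set.uIcc a b) : Integrable fun x : ℝ => f (x + v * Complex.I) :=
    hCi.mono' (by have := hf.continuous; exact Continuous.aestronglyMeasurable (by fun_prop))
      (ae_of_all _ fun x => hC x v hv)
  have hlim (v : ℝ) (hv : v ∈ Set.uIcc a b) :=
    intervalIntegral_tendsto_integral (hint v hv) tendsto_neg_atTop_atBot tendsto_id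
  have h0 (l : Filter ℝ) (h : Tendsto C l (𝓝 0)) :
      Tendsto (fun x : ℝ => F (x + b * Complex.I) - F (x + a * Complex.I)) l (𝓝 0) :=
    squeeze_zero_norm (fun x => norm_sub_le_of_vertical_segment hF (hC x))
      (by simpa using h.mul_const |b - a|)
  have key := (hlim b Set.right_mem_uIcc).sub (hlim a Set.left_mem_uIcc)
  have h2 := (h0 _ htop).sub ((h0 _ hbot).comp tendsto_neg_atTop_atBot)
  refine (sub_eq_zero.mp (tendsto_nhds_unique key ?_)).symm
  rw [sub_zero] at h2
  refine h2.congr fun x => ?_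
  simp only [intervalIntegral_horizontal hF hf.continuous, id, Function.comp]
  ring

theorem norm_exp_neg_I_mul_cube_div_six (x v : ℝ) :
    ‖Complex.exp (-Complex.I * (x + v * Complex.I) ^ 3 / 6)‖ =
      Real.exp (v * x ^ 2 / 2 - v ^ 3 / 6) := by
  have : -Complex.I * (x + v * Complex.I) ^ 3 / 6 =
      ((v * x ^ 2 / 2 - v ^ 3 / 6 : ℝ) : ℂ) +
        ((-(x ^ 3 - 3 * x * v ^ 2) / 6 : ℝ) : ℂ) * Complex.I := by
    push_cast
    linear_combination (-(v * x ^ 2 / 2 : ℂ) - v ^ 3 * (Complex.I ^ 2 - 1) / 6 -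
      x * v ^ 2 * Complex.I / 2) * Complex.I_sq
  rw [Complex.norm_exp, this, Complex.add_re, Complex.ofReal_re, Complex.re_ofReal_mul,
    Complex.I_re, mul_zero, add_zero]

theorem tendsto_primitive_vertical_ray {F : ℂ → ℂ}
    (hF : ∀ z, HasDerivAt F (Complex.exp (-Complex.I * z ^ 3 / 6)) z) {s : ℝ} (hs : s ^ 2 = 3 / 4) :
    Tendsto (fun T : ℝ => F ((s * T : ℝ) + ((-1 : ℝ) : ℂ) * Complex.I) -
      F ((s * T : ℝ) + ((-T / 2 : ℝ) : ℂ) * Complex.I)) atTop (𝓝 0) := by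
  have h := Real.tendsto_pow_mul_exp_neg_atTop_nhds_zero 1
  refine squeeze_zero_norm' ?_ h
  filter_upwards [eventually_ge_atTop (3 : ℝ)] with T hT
  refine (norm_sub_le_of_vertical_segment hF (C := Real.exp (-T))
    fun v hv => ?_).trans ?_
  · rw [Set.uIcc_of_le (by linarith)] at hv
    obtain ⟨h1, h2⟩ := hv
    rw [norm_exp_neg_I_mul_cube_div_six, Real.exp_le_exp, mul_pow, hs]
    have h3 : v ^ 2 ≤ T ^ 2 / 4 := by nlinarith
    have h4 : -v ^ 3 ≤ -v * (T ^ 2 / 4) := by nlinarith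
    nlinarith [mul_nonneg (by linarith : (0:ℝ) ≤ -1 - v) (sq_nonneg T)]
  · rw [pow_one, mul_comm, abs_of_nonneg (by linarith)]
    gcongr
    linarith

theorem integrable_exp_neg_cube_div_six :
    IntegrableOn (fun t : ℝ => Real.exp (-(1 / 6) * t ^ (3 : ℝ))) (Set.Ioi 0) := by
  have := integrableOn_rpow_mul_exp_neg_mul_rpow (s := 0) (p := 3) (b := 1 / 6)
    (by norm_num) (by norm_num) (by norm_num)
  simpa using this

theorem tendsto_primitive_ray {F : ℂ → ℂ}
    (hF : ∀ z, HasDerivAt F (Complex.exp (-Complex.I * z ^ 3 / 6)) z) {s : ℝ} (hs : s ^ 2 = 3 / 4) :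
    Tendsto (fun T : ℝ => F ((s * T : ℝ) + ((-1 : ℝ) : ℂ) * Complex.I)) atTop
      (𝓝 (F 0 + (∫ t in Set.Ioi (0 : ℝ), Real.exp (-(1 / 6) * t ^ (3 : ℝ)) : ℝ) *
        (s - Complex.I / 2))) := by
  have hi : IntegrableOn (fun t : ℝ => ((Real.exp (-(1 / 6) * t ^ (3 : ℝ)) : ℝ) : ℂ))
    (Set.Ioi 0) := integrable_exp_neg_cube_div_six.ofReal
  have h1 := (intervalIntegral_tendsto_integral_Ioi 0 hi tendsto_id).mul_const (s - Complex.I / 2)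
  have h2 := (tendsto_primitive_vertical_ray hF hs).add (h1.const_add (F 0))
  rw [zero_add, integral_complex_ofReal] at h2
  refine h2.congr' ?_
  filter_upwards [eventually_ge_atTop (0 : ℝ)] with T hT
  have hline := intervalIntegral_along_line hF (by fun_prop) 0 (s - Complex.I / 2) 0 T
  have hcongr : ∫ x in (0 : ℝ)..T, Complex.exp (-Complex.I * (0 + x * (s - Complex.I / 2)) ^ 3 / 6) *
        (s - Complex.I / 2) =
      ∫ x in (0 : ℝ)..T, ((Real.exp (-(1 / 6) * x ^ (3 : ℝ)) : ℝ) : ℂ) * (s - Complex.I / 2) := by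
    refine intervalIntegral.integral_congr fun x _ => ?_
    have hsc : (s : ℂ) ^ 2 = 3 / 4 := by rw [← Complex.ofReal_pow, hs]; norm_num
    have hcube : ((s : ℂ) - Complex.I / 2) ^ 3 = -Complex.I := by
      linear_combination (s - 3 / 2 * Complex.I) * hsc + (3 / 4 * s - Complex.I / 8) * Complex.I_sq
    have hx : (x : ℝ) ^ (3 : ℝ) = x ^ 3 := by
      rw [← Real.rpow_natCast]; norm_num
    simp only [zero_add, mul_pow, hcube, hx]
    push_cast
    congr 2
    linear_combination (x : ℂ) ^ 3 / 6 * Complex.I_sq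
  rw [hcongr, intervalIntegral.integral_mul_const] at hline
  simp only [id]
  rw [hline]
  have e : (0 : ℂ) + T * (s - Complex.I / 2) =
      (s * T : ℝ) + ((-T / 2 : ℝ) : ℂ) * Complex.I := by push_cast; ring
  rw [e]
  simp

theorem integral_exp_neg_I_mul_cube_div_six :
    ∫ u : ℝ, Complex.exp (-Complex.I * (u + ((-1 : ℝ) : ℂ) * Complex.I) ^ 3 / 6) =
      ((2 * (Real.Gamma (1 / 3) / (2 ^ ((2 : ℝ) / 3) * 3 ^ ((1 : ℝ) / 6))) : ℝ) : ℂ) := by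
  obtain ⟨F, hF'⟩ := (show Differentiable ℂ fun z : ℂ => Complex.exp (-Complex.I * z ^ 3 / 6) by
    fun_prop).isExactOn_univ
  have hF : ∀ z, HasDerivAt F (Complex.exp (-Complex.I * z ^ 3 / 6)) z :=
    fun z => hF' z (Set.mem_univ z)
  have hint : Integrable fun u : ℝ =>
      Complex.exp (-Complex.I * (u + ((-1 : ℝ) : ℂ) * Complex.I) ^ 3 / 6) := by
    refine ((integrable_exp_neg_mul_sq (b := 1 / 2) (by norm_num)).const_mul
      (Real.exp (1 / 6))).mono' (Continuous.aestronglyMeasurable (by fun_prop))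
      (ae_of_all _ fun u => ?_)
    rw [norm_exp_neg_I_mul_cube_div_six, ← Real.exp_add, Real.exp_le_exp]
    linarith
  set s := √3 / 2 with hs_def
  have hs0 : 0 < s := by positivity
  have hs : s ^ 2 = 3 / 4 := by rw [hs_def, div_pow]; norm_num
  have hT : Tendsto (fun T : ℝ => s * T) atTop atTop := tendsto_id.const_mul_atTop hs0
  have h1 := intervalIntegral_tendsto_integral hint (tendsto_neg_atTop_atBot.comp hT) hT
  have h2 := (tendsto_primitive_ray hF hs).sub (tendsto_primitive_ray hF (s := -s) (by simpa))
  have h3 := tendsto_nhds_unique h1 (h2.congr fun T => by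
    rw [intervalIntegral_horizontal hF (by fun_prop)]
    simp)
  rw [h3, integral_exp_neg_mul_rpow (by norm_num) (by norm_num), Real.Gamma_add_one (by norm_num)]
  have h6 : (1 / 6 : ℝ) ^ (-1 / 3 : ℝ) = 2 ^ (1 / 3 : ℝ) * 3 ^ (1 / 3 : ℝ) := by
    rw [← Real.mul_rpow (by norm_num) (by norm_num), one_div, Real.inv_rpow (by norm_num),
      ← Real.rpow_neg (by norm_num)]
    norm_num
  have hc : √3 * ((1 / 6 : ℝ) ^ (-1 / 3 : ℝ) * (1 / 3)) =
      2 / (2 ^ ((2 : ℝ) / 3) * 3 ^ ((1 : ℝ) / 6)) := by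
    rw [eq_div_iff (by positivity), Real.sqrt_eq_rpow, h6]
    have h2 : (2 : ℝ) ^ (1 / 3 : ℝ) * 2 ^ ((2 : ℝ) / 3) = 2 := by
      rw [← Real.rpow_add (by norm_num)]; norm_num
    have h3 : (3 : ℝ) ^ (1 / 2 : ℝ) * 3 ^ (1 / 3 : ℝ) * 3 ^ ((1 : ℝ) / 6) = 3 := by
      rw [← Real.rpow_add (by norm_num), ← Real.rpow_add (by norm_num)]; norm_num
    linear_combination (1 / 3 * 3 ^ (1 / 2 : ℝ) * 3 ^ (1 / 3 : ℝ) * 3 ^ ((1 : ℝ) / 6)) * h2 +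
      2 / 3 * h3
  have hc' : 2 * (Real.Gamma (1 / 3) / (2 ^ ((2 : ℝ) / 3) * 3 ^ ((1 : ℝ) / 6))) =
      (1 / 6 : ℝ) ^ (-1 / 3 : ℝ) * (1 / 3 * Real.Gamma (1 / 3)) * (2 * s) := by
    rw [hs_def]
    linear_combination -Real.Gamma (1 / 3) * hc
  rw [hc']
  push_cast
  ring

theorem one_add_sq_div_two_le_cosh (x : ℝ) : 1 + x ^ 2 / 2 ≤ Real.cosh x := by
  have h1 : Real.cosh x = 1 + 2 * Real.sinh (x / 2) ^ 2 := by
    have := Real.cosh_two_mul (x / 2)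
    rw [mul_div_cancel₀ x two_ne_zero, Real.cosh_sq] at this
    linarith
  have h2 : (x / 2) ^ 2 ≤ Real.sinh (x / 2) ^ 2 := by
    rw [sq_le_sq, Real.abs_sinh]
    exact Real.self_le_sinh_iff.mpr (abs_nonneg _)
  linarith

theorem norm_kernel (y r x v : ℝ) :
    ‖Complex.exp (-(y : ℂ) * Complex.cosh (x + v * Complex.I) +
      (r + y * Complex.I) * (x + v * Complex.I))‖ =
      Real.exp (-y * (Real.cosh x * Real.cos v) + (r * x - y * v)) := by
  rw [Complex.norm_exp, Complex.cosh_add, Complex.cosh_mul_I, Complex.sinh_mul_I,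
    ← Complex.ofReal_cosh, ← Complex.ofReal_sinh, ← Complex.ofReal_cos, ← Complex.ofReal_sin]
  simp [-Complex.ofReal_cosh, -Complex.ofReal_sinh, -Complex.ofReal_cos, -Complex.ofReal_sin]

theorem norm_kernel_le {y : ℝ} (hy : 0 < y) (r x : ℝ) {v b : ℝ} (hv : v ∈ Set.Icc 0 b)
    (hb : b < Real.pi / 2) :
    ‖Complex.exp (-(y : ℂ) * Complex.cosh (x + v * Complex.I) +
      (r + y * Complex.I) * (x + v * Complex.I))‖ ≤
      Real.exp (r ^ 2 / (y * Real.cos b)) * Real.exp (-(y * Real.cos b / 4) * x ^ 2) := by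
  have hcos : Real.cos b ≤ Real.cos v :=
    Real.cos_le_cos_of_nonneg_of_le_pi hv.1 (by linarith [Real.pi_pos]) hv.2
  have hcb : 0 < Real.cos b :=
    Real.cos_pos_of_mem_Ioo ⟨by linarith [Real.pi_pos, hv.1.trans hv.2], hb⟩
  have hk : 0 < y * Real.cos b := by positivity
  rw [norm_kernel, ← Real.exp_add, Real.exp_le_exp]
  have h1 : x ^ 2 / 2 * (y * Real.cos b) ≤ y * (Real.cosh x * Real.cos v) := by
    calc x ^ 2 / 2 * (y * Real.cos b) ≤ Real.cosh x * (y * Real.cos v) := by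
          have := one_add_sq_div_two_le_cosh x
          gcongr
          linarith
      _ = _ := by ring
  have h2 : r * x ≤ r ^ 2 / (y * Real.cos b) + y * Real.cos b / 4 * x ^ 2 := by
    have h3 : r ^ 2 / (y * Real.cos b) + y * Real.cos b / 4 * x ^ 2 - r * x =
        (r - y * Real.cos b / 2 * x) ^ 2 / (y * Real.cos b) := by
      field_simp
      ring
    have : 0 ≤ (r - y * Real.cos b / 2 * x) ^ 2 / (y * Real.cos b) := by positivity
    linarith
  have h4 : 0 ≤ y * v := mul_nonneg hy.le hv.1
  linarith

/-- Up to an exponential factor, the integrand of the K-Bessel function of order `r + i y` at `y`,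
recentred at the double saddle point `i π / 2` and rescaled by `δ = y ^ (-1 / 3)`. -/
noncomputable def saddleIntegrand (r δ u : ℝ) : ℂ :=
  Complex.exp (Complex.I * (δ * (u - Complex.I) - Complex.sinh (δ * (u - Complex.I))) / δ ^ 3 +
    r * (δ * (u - Complex.I)))

theorem KBessel_eq_integral_saddleIntegrand (r : ℝ) {δ : ℝ} (hδ : 0 < δ) (hδ1 : δ ≤ 1) :
    KBessel (r + ((δ ^ 3)⁻¹ : ℝ) * Complex.I) (δ ^ 3)⁻¹ =
      1 / 2 * (Complex.exp (-(((Real.pi / 2) : ℝ) : ℂ) * ((δ ^ 3)⁻¹ : ℝ) +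
        Complex.I * (((Real.pi / 2) : ℝ) : ℂ) * r) * (δ * ∫ u : ℝ, saddleIntegrand r δ u)) := by
  set y := (δ ^ 3)⁻¹ with hy_def
  have hy : 0 < y := by positivity
  set b := Real.pi / 2 - δ with hb_def
  have hb0 : 0 ≤ b := by linarith [Real.pi_gt_three]
  have hb : b < Real.pi / 2 := by linarith
  have hcb : 0 < Real.cos b :=
    Real.cos_pos_of_mem_Ioo ⟨by linarith [Real.pi_pos], hb⟩
  have hk : 0 < y * Real.cos b / 4 := by positivity
  have hlim (l : Filter ℝ) (hl : Tendsto (fun x : ℝ => x ^ 2) l atTop) :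
      Tendsto (fun x => Real.exp (r ^ 2 / (y * Real.cos b)) *
        Real.exp (-(y * Real.cos b / 4) * x ^ 2)) l (𝓝 0) := by
    simpa using (Real.tendsto_exp_atBot.comp
      (hl.const_mul_atTop_of_neg (neg_lt_zero.mpr hk))).const_mul
        (Real.exp (r ^ 2 / (y * Real.cos b)))
  have hshift := integral_horizontal_eq (a := 0) (b := b)
    (f := fun z => Complex.exp (-(y : ℂ) * Complex.cosh z + (r + y * Complex.I) * z))
    (by fun_prop)
    (fun x v hv => norm_kernel_le hy r x (by rwa [Set.uIcc_of_le hb0] at hv) hb)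
    ((integrable_exp_neg_mul_sq hk).const_mul _)
    (hlim _ (by simpa [Function.comp_def] using
      (tendsto_pow_atTop (α := ℝ) two_ne_zero).comp tendsto_abs_atBot_atTop))
    (hlim _ (tendsto_pow_atTop two_ne_zero))
  have hscale := Measure.integral_comp_mul_left
    (fun x : ℝ => Complex.exp (-(y : ℂ) * Complex.cosh (x + b * Complex.I) +
      (r + y * Complex.I) * (x + b * Complex.I))) δ
  rw [KBessel]
  congr 1
  simp only [Complex.ofReal_zero, zero_mul, add_zero] at hshift
  simp only [Complex.ofReal_cosh]
  rw [hshift]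
  rw [abs_of_pos (inv_pos.mpr hδ), Complex.real_smul] at hscale
  have hδc : (δ : ℂ) ≠ 0 := by exact_mod_cast hδ.ne'
  have hsub (u : ℝ) : Complex.exp (-(y : ℂ) * Complex.cosh (((δ * u : ℝ) : ℂ) + b * Complex.I) +
      (r + y * Complex.I) * (((δ * u : ℝ) : ℂ) + b * Complex.I)) =
      Complex.exp (-(((Real.pi / 2) : ℝ) : ℂ) * y +
        Complex.I * (((Real.pi / 2) : ℝ) : ℂ) * r) * saddleIntegrand r δ u := by
    have e : ((δ * u : ℝ) : ℂ) + b * Complex.I =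
        δ * (u - Complex.I) + ((Real.pi / 2 : ℝ) : ℂ) * Complex.I := by
      rw [hb_def]; push_cast; ring
    have ey : (y : ℂ) = ((δ : ℂ) ^ 3)⁻¹ := by rw [hy_def]; push_cast; rfl
    rw [e, saddleIntegrand, ← Complex.exp_add, Complex.cosh_add, Complex.cosh_mul_I,
      Complex.sinh_mul_I, ← Complex.ofReal_cos, ← Complex.ofReal_sin, Real.cos_pi_div_two,
      Real.sin_pi_div_two, div_eq_mul_inv _ ((δ : ℂ) ^ 3), ← ey]
    congr 1
    push_cast
    linear_combination (y * (Real.pi / 2) : ℂ) * Complex.I_sq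
  simp only [hsub, integral_const_mul] at hscale
  rw [mul_left_comm, hscale, Complex.ofReal_inv δ, mul_inv_cancel_left₀ hδc]

theorem norm_saddleIntegrand_le (r : ℝ) {δ : ℝ} (hδ : 0 < δ) (hδ1 : δ ≤ 1) (u : ℝ) :
    ‖saddleIntegrand r δ u‖ ≤ Real.exp (1 / 6 + 2 * r ^ 2) * Real.exp (-(1 / 8) * u ^ 2) := by
  have e : (δ : ℂ) * (u - Complex.I) = ((δ * u : ℝ) : ℂ) + ((-δ : ℝ) : ℂ) * Complex.I := by
    push_cast; ring
  rw [saddleIntegrand, e, Complex.norm_exp, Complex.sinh_add, Complex.cosh_mul_I,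
    Complex.sinh_mul_I, ← Complex.ofReal_cosh, ← Complex.ofReal_sinh, ← Complex.ofReal_cos,
    ← Complex.ofReal_sin, ← Complex.ofReal_pow, ← Real.exp_add, Real.exp_le_exp]
  have hre : (Complex.I * (((δ * u : ℝ) : ℂ) + ((-δ : ℝ) : ℂ) * Complex.I -
      (((Real.sinh (δ * u) : ℝ) : ℂ) * ((Real.cos (-δ) : ℝ) : ℂ) +
        ((Real.cosh (δ * u) : ℝ) : ℂ) * (((Real.sin (-δ) : ℝ) : ℂ) * Complex.I))) /
        ((δ ^ 3 : ℝ) : ℂ) +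
      r * (((δ * u : ℝ) : ℂ) + ((-δ : ℝ) : ℂ) * Complex.I)).re =
      (δ - Real.cosh (δ * u) * Real.sin δ) / δ ^ 3 + r * (δ * u) := by
    rw [Complex.add_re, Complex.div_ofReal_re, Complex.re_ofReal_mul]
    simp [-Complex.ofReal_mul, -Complex.ofReal_neg, -Complex.ofReal_cosh, -Complex.ofReal_sinh,
      -Complex.ofReal_cos, -Complex.ofReal_sin]
    ring
  rw [hre]
  have h1 : δ - δ ^ 3 / 6 < Real.sin δ := Real.sin_gt_sub_cube hδ
  have h2 : δ / 2 ≤ Real.sin δ := by nlinarith [pow_le_one₀ (n := 2) hδ.le hδ1]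
  have h3 := one_add_sq_div_two_le_cosh (δ * u)
  have h4 : (δ - Real.cosh (δ * u) * Real.sin δ) / δ ^ 3 ≤ 1 / 6 - u ^ 2 / 4 := by
    rw [div_le_iff₀ (by positivity)]
    have h5 : (1 + (δ * u) ^ 2 / 2) * Real.sin δ ≤ Real.cosh (δ * u) * Real.sin δ := by
      gcongr
      linarith
    have h6 : (δ * u) ^ 2 / 2 * (δ / 2) ≤ (δ * u) ^ 2 / 2 * Real.sin δ := by gcongr
    nlinarith
  have h7 : r * (δ * u) ≤ 2 * r ^ 2 + u ^ 2 / 8 := by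
    have : (δ * u) ^ 2 ≤ u ^ 2 := by
      rw [mul_pow]
      exact mul_le_of_le_one_left (sq_nonneg u) (pow_le_one₀ hδ.le hδ1)
    nlinarith [sq_nonneg (4 * r - δ * u)]
  linarith

theorem norm_sinh_sub_self_sub_cube_le (w : ℂ) :
    ‖Complex.sinh w - w - w ^ 3 / 6‖ ≤ ‖w‖ ^ 4 * Real.exp ‖w‖ := by
  have h1 := Complex.norm_exp_sub_sum_le_norm_mul_exp w 4
  have h2 := Complex.norm_exp_sub_sum_le_norm_mul_exp (-w) 4
  rw [norm_neg] at h2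
  have e : Complex.sinh w - w - w ^ 3 / 6 =
      ((Complex.exp w - ∑ m ∈ Finset.range 4, w ^ m / m.factorial) -
        (Complex.exp (-w) - ∑ m ∈ Finset.range 4, (-w) ^ m / m.factorial)) / 2 := by
    simp [Finset.sum_range_succ, Complex.sinh, Nat.factorial]
    ring
  rw [e, norm_div, Complex.norm_ofNat, div_le_iff₀ two_pos]
  refine (norm_sub_le _ _).trans ?_
  linarith

theorem tendsto_saddleIntegrand (r u : ℝ) :
    Tendsto (fun δ => saddleIntegrand r δ u) (𝓝[>] 0)
      (𝓝 (Complex.exp (-Complex.I * (u + ((-1 : ℝ) : ℂ) * Complex.I) ^ 3 / 6))) := by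
  set z : ℂ := u - Complex.I with hz
  have hz' : (u : ℂ) + ((-1 : ℝ) : ℂ) * Complex.I = z := by rw [hz]; push_cast; ring
  have h0 : Tendsto (fun δ : ℝ => Complex.I * ((δ * z) - Complex.sinh (δ * z)) / δ ^ 3 -
      -Complex.I * z ^ 3 / 6) (𝓝[>] 0) (𝓝 0) := by
    have hlim : Tendsto (fun δ : ℝ => δ * ‖z‖ ^ 4 * Real.exp (δ * ‖z‖)) (𝓝[>] 0) (𝓝 0) := by
      have : Continuous fun δ : ℝ => δ * ‖z‖ ^ 4 * Real.exp (δ * ‖z‖) := by fun_prop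
      simpa using (this.tendsto 0).mono_left nhdsWithin_le_nhds
    refine squeeze_zero_norm' ?_ hlim
    filter_upwards [self_mem_nhdsWithin] with δ (hδ : 0 < δ)
    have hδc : (δ : ℂ) ≠ 0 := by exact_mod_cast hδ.ne'
    have e : Complex.I * ((δ * z) - Complex.sinh (δ * z)) / δ ^ 3 - -Complex.I * z ^ 3 / 6 =
        -Complex.I * (Complex.sinh (δ * z) - δ * z - (δ * z) ^ 3 / 6) / δ ^ 3 := by
      field_simp
      ring
    have hn : ‖(δ : ℂ)‖ = δ := by simp [abs_of_pos hδ]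
    rw [e, norm_div, norm_mul, norm_neg, Complex.norm_I, one_mul, norm_pow, hn,
      div_le_iff₀ (by positivity)]
    refine (norm_sinh_sub_self_sub_cube_le _).trans_eq ?_
    rw [norm_mul, hn]
    ring
  have h1 : Tendsto (fun δ : ℝ => (r : ℂ) * (δ * z)) (𝓝[>] 0) (𝓝 0) := by
    have : Continuous fun δ : ℝ => (r : ℂ) * (δ * z) := by fun_prop
    simpa using (this.tendsto 0).mono_left nhdsWithin_le_nhds
  have h2 := ((h0.add h1).add_const (-Complex.I * z ^ 3 / 6)).cexp
  rw [hz']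
  simp only [add_zero, zero_add] at h2
  refine h2.congr fun δ => ?_
  rw [saddleIntegrand, ← hz]
  congr 1
  ring

theorem tendsto_integral_saddleIntegrand (r : ℝ) :
    Tendsto (fun δ => ∫ u : ℝ, saddleIntegrand r δ u) (𝓝[>] 0)
      (𝓝 ((2 * (Real.Gamma (1 / 3) / (2 ^ ((2 : ℝ) / 3) * 3 ^ ((1 : ℝ) / 6))) : ℝ) : ℂ)) := by
  rw [← integral_exp_neg_I_mul_cube_div_six]
  refine tendsto_integral_filter_of_dominated_convergence _
    (Eventually.of_forall fun δ => ?_) ?_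
    ((integrable_exp_neg_mul_sq (b := 1 / 8) (by norm_num)).const_mul
      (Real.exp (1 / 6 + 2 * r ^ 2)))
    (ae_of_all _ fun u => tendsto_saddleIntegrand r u)
  · unfold saddleIntegrand
    exact Continuous.aestronglyMeasurable (by fun_prop)
  · filter_upwards [Ioc_mem_nhdsGT one_pos] with δ hδ
    exact ae_of_all _ fun u => norm_saddleIntegrand_le r hδ.1 hδ.2 u

theorem kbessel_asymptotic_theta_pi_div_two (M : ℝ) (hM : 0 ≤ M) (r : ℝ) (hr : |r| ≤ M) :
    Tendsto (fun y : ℝ =>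
      KBessel ((r : ℂ) + (y : ℂ) * Complex.I) y /
        (Complex.exp (-(((Real.pi / 2) : ℝ) : ℂ) * (y : ℂ) +
            Complex.I * (((Real.pi / 2) : ℝ) : ℂ) * (r : ℂ)) *
          ((y ^ (-(1 : ℝ) / 3) : ℝ) : ℂ) *
          ((Real.Gamma (1 / 3) / (2 ^ ((2 : ℝ) / 3) * 3 ^ ((1 : ℝ) / 6)) : ℝ) : ℂ)))
      atTop (𝓝 1) := by
  set c : ℝ := Real.Gamma (1 / 3) / (2 ^ ((2 : ℝ) / 3) * 3 ^ ((1 : ℝ) / 6)) with hc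
  have hc0 : 0 < c := by
    have := Real.Gamma_pos_of_pos (show (0 : ℝ) < 1 / 3 by norm_num)
    positivity
  have hcc : (c : ℂ) ≠ 0 := by exact_mod_cast hc0.ne'
  have hδ : Tendsto (fun y : ℝ => y ^ (-(1 : ℝ) / 3)) atTop (𝓝[>] 0) := by
    refine tendsto_nhdsWithin_iff.mpr ⟨?_, ?_⟩
    · rw [neg_div]
      exact tendsto_rpow_neg_atTop (by norm_num)
    · filter_upwards [eventually_gt_atTop 0] with y hy
      exact Real.rpow_pos_of_pos hy _
  have hlim := ((tendsto_integral_saddleIntegrand r).comp hδ).div_const ((2 * c : ℝ) : ℂ)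
  rw [div_self (by exact_mod_cast (by positivity : 2 * c ≠ 0))] at hlim
  refine hlim.congr' ?_
  filter_upwards [eventually_ge_atTop 1] with y hy
  have hy0 : 0 < y := by linarith
  have hd0 : 0 < y ^ (-(1 : ℝ) / 3) := Real.rpow_pos_of_pos hy0 _
  have hd1 : y ^ (-(1 : ℝ) / 3) ≤ 1 := Real.rpow_le_one_of_one_le_of_nonpos hy (by norm_num)
  have hyd : ((y ^ (-(1 : ℝ) / 3)) ^ 3)⁻¹ = y := by
    rw [← Real.rpow_natCast, ← Real.rpow_mul hy0.le, ← Real.rpow_neg hy0.le]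
    norm_num
  have hK := KBessel_eq_integral_saddleIntegrand r hd0 hd1
  rw [hyd] at hK
  have hdc : ((y ^ (-(1 : ℝ) / 3) : ℝ) : ℂ) ≠ 0 := by exact_mod_cast hd0.ne'
  rw [hK, Function.comp_apply]
  set E := Complex.exp (-(((Real.pi / 2) : ℝ) : ℂ) * (y : ℂ) +
    Complex.I * (((Real.pi / 2) : ℝ) : ℂ) * (r : ℂ)) with hE
  have hE0 : E ≠ 0 := Complex.exp_ne_zero _
  generalize y ^ (-(1 : ℝ) / 3) = d at hdc ⊢
  rw [Complex.ofReal_mul, Complex.ofReal_ofNat]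
  field_simp
end

section
/- Let 0 < θ < π/2, r ∈ ℝ, y > 0, t = y sin θ and ν = r + it. Then K_ν(y) = (1/2) ∫_{-∞}^{∞} exp(−y(cosh u · cos w(u) + w(u) sin θ)) · e^{ru} · e^{i r w(u)} · (1 + i w'(u)) du, where w(u) = arcsin(sin θ · u/sinh u) for u ≠ 0 and w(0) = θ. -/
open MeasureTheory Filter Topology

/-- The steepest-descent height function `w(u) = arcsin(sin θ · u / sinh u)` with `w(0) = θ`. -/
noncomputable def wSD (θ u : ℝ) : ℝ :=
  if u = 0 then θ else Real.arcsin (Real.sin θ * u / Real.sinh u)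

theorem norm_sub_le_of_hasDerivAt_vertical {F f : ℂ → ℂ} {T θ C v : ℝ}
    (hF : ∀ s, 0 ≤ s → s ≤ θ → HasDerivAt F (f (T + s * Complex.I)) (T + s * Complex.I))
    (hC : ∀ s : ℝ, 0 ≤ s → s ≤ θ → ‖f (T + s * Complex.I)‖ ≤ C)
    (hv₀ : 0 ≤ v) (hv : v ≤ θ) :
    ‖F (T + v * Complex.I) - F T‖ ≤ C * θ := by
  have hG : ∀ s ∈ Set.Icc 0 θ, HasDerivWithinAt (fun s : ℝ => F (T + s * Complex.I))
      (f (T + s * Complex.I) * Complex.I) (Set.Icc 0 θ) s := by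
    intro s hs
    have h₁ : HasDerivAt (fun s : ℝ => (T : ℂ) + s * Complex.I) Complex.I s := by
      simpa using ((Complex.ofRealCLM.hasDerivAt (x := s)).mul_const Complex.I).const_add (T : ℂ)
    exact ((hF s hs.1 hs.2).comp s h₁).hasDerivWithinAt
  have h := Convex.norm_image_sub_le_of_norm_hasDerivWithin_le (C := C) hG
    (fun s hs => by simpa using hC s hs.1 hs.2) (convex_Icc 0 θ)
    ⟨le_rfl, hv₀.trans hv⟩ ⟨hv₀, hv⟩
  have hC₀ : 0 ≤ C := (norm_nonneg _).trans (hC v hv₀ hv)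
  simp only [Complex.ofReal_zero, zero_mul, add_zero, sub_zero, Real.norm_eq_abs,
    abs_of_nonneg hv₀] at h
  exact h.trans (mul_le_mul_of_nonneg_left hv hC₀)

/-- The integral of an entire function over the real line equals its integral over the graph of a
function `w` with bounded derivative, when `f` is dominated by an integrable function of the real
part that vanishes at infinity. -/
theorem integral_eq_integral_graph {f : ℂ → ℂ} (hf : Differentiable ℂ f) {w g : ℝ → ℝ} {θ L : ℝ}
    (hw : Continuous w) (hw₀ : ∀ u, 0 ≤ w u) (hwθ : ∀ u, w u ≤ θ)
    (hd : ∀ u, u ≠ 0 → DifferentiableAt ℝ w u) (hL : ∀ u, u ≠ 0 → |deriv w u| ≤ L)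
    (hg : Integrable g) (hg₀ : Tendsto (fun T => g T + g (-T)) atTop (𝓝 0))
    (hb : ∀ u v : ℝ, 0 ≤ v → v ≤ θ → ‖f (u + v * Complex.I)‖ ≤ g u) :
    ∫ u : ℝ, f u =
      ∫ u : ℝ, f (u + w u * Complex.I) * (1 + Complex.I * (deriv w u : ℝ)) := by
  have hθ : 0 ≤ θ := (hw₀ 0).trans (hwθ 0)
  have hi₁ : Integrable (fun u : ℝ => f u) := by
    refine hg.mono' (hf.continuous.comp Complex.continuous_ofReal).aestronglyMeasurable
      (Eventually.of_forall fun u => ?_)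
    simpa using hb u 0 le_rfl hθ
  have hi₂ : Integrable
      (fun u : ℝ => f (u + w u * Complex.I) * (1 + Complex.I * (deriv w u : ℝ))) := by
    refine (hg.mul_const (1 + L)).mono' ?_ ?_
    · have h₁ : Continuous fun u : ℝ => f (u + w u * Complex.I) := by
        have := hf.continuous
        fun_prop
      have h₂ : Measurable fun u : ℝ => (1 : ℂ) + Complex.I * (deriv w u : ℝ) :=
        ((Complex.measurable_ofReal.comp (measurable_deriv w)).const_mul _).const_add _
      exact (h₁.measurable.mul h₂).aestronglyMeasurable
    · have h₀ : ∀ᵐ u : ℝ, u ≠ 0 := Measure.ae_ne volume 0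
      filter_upwards [h₀] with u hu
      have h₁ : ‖(1 : ℂ) + Complex.I * (deriv w u : ℝ)‖ ≤ 1 + L := by
        refine (norm_add_le _ _).trans ?_
        simpa using hL u hu
      rw [norm_mul]
      exact mul_le_mul (hb u _ (hw₀ u) (hwθ u)) h₁ (norm_nonneg _)
        ((norm_nonneg _).trans (hb u _ (hw₀ u) (hwθ u)))
  have key : ∀ T : ℝ, 0 ≤ T →
      ‖(∫ u in (-T)..T, f (u + w u * Complex.I) * (1 + Complex.I * (deriv w u : ℝ)))
        - ∫ u in (-T)..T, f u‖ ≤ (g T + g (-T)) * θ := by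
    intro T hT
    obtain ⟨F, hF⟩ := (hf.differentiableOn (s := Metric.ball 0 (T + θ + 1))).isExactOn_ball
    have hmem : ∀ u v : ℝ, |u| ≤ T → 0 ≤ v → v ≤ θ →
        HasDerivAt F (f (u + v * Complex.I)) (u + v * Complex.I) := by
      intro u v hu hv₀ hv
      apply hF
      rw [mem_ball_zero_iff]
      refine (norm_add_le _ _).trans_lt ?_
      simp only [Complex.norm_real, Real.norm_eq_abs, norm_mul, Complex.norm_I, mul_one,
        abs_of_nonneg hv₀]
      linarith
    have hmem₀ : ∀ u : ℝ, |u| ≤ T → HasDerivAt F (f u) u := by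
      intro u hu
      simpa using hmem u 0 hu le_rfl hθ
    have hI₁ : ∫ u in (-T)..T, f u = F T - F (-T) := by
      have h := intervalIntegral.integral_eq_sub_of_hasDerivAt (a := -T) (b := T)
        (f := fun u : ℝ => F u) (f' := fun u : ℝ => f u)
        (fun u hu => by
          rw [Set.uIcc_of_le (by linarith)] at hu
          exact (hmem₀ u (abs_le.2 hu)).comp_ofReal) hi₁.intervalIntegrable
      simpa using h
    have hI₂ : ∫ u in (-T)..T, f (u + w u * Complex.I) * (1 + Complex.I * (deriv w u : ℝ)) =
        F (T + w T * Complex.I) - F ((-T : ℝ) + w (-T) * Complex.I) := by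
      refine MeasureTheory.integral_eq_of_hasDerivAt_off_countable_of_le
        (fun u : ℝ => F (u + w u * Complex.I)) _ (by linarith) (Set.countable_singleton (0 : ℝ))
        ?_ ?_ hi₂.intervalIntegrable
      · intro u hu
        have h₁ : ContinuousAt (fun u : ℝ => (u : ℂ) + w u * Complex.I) u := by fun_prop
        exact (ContinuousAt.comp (f := fun u : ℝ => (u : ℂ) + w u * Complex.I)
          (hmem u (w u) (abs_le.2 hu) (hw₀ u) (hwθ u)).continuousAt h₁).continuousWithinAt
      · intro u hu
        have h₁ : HasDerivAt (fun u : ℝ => (u : ℂ) + w u * Complex.I)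
            (1 + Complex.I * (deriv w u : ℝ)) u := by
          have h₂ := (hd u hu.2).hasDerivAt.ofReal_comp.mul_const Complex.I
          rw [mul_comm Complex.I]
          exact (Complex.ofRealCLM.hasDerivAt (x := u)).add h₂
        exact (hmem u (w u) (abs_le.2 ⟨hu.1.1.le, hu.1.2.le⟩) (hw₀ u) (hwθ u)).comp u h₁
    have h₁ := norm_sub_le_of_hasDerivAt_vertical (F := F) (f := f) (T := T) (θ := θ)
      (fun s hs₀ hs => hmem T s (abs_of_nonneg hT).le hs₀ hs) (hb T) (hw₀ T) (hwθ T)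
    have h₂ := norm_sub_le_of_hasDerivAt_vertical (F := F) (f := f) (T := -T) (θ := θ)
      (fun s hs₀ hs => hmem (-T) s (by rw [abs_neg, abs_of_nonneg hT]) hs₀ hs) (hb (-T))
      (hw₀ (-T)) (hwθ (-T))
    rw [hI₁, hI₂, add_mul]
    refine le_trans (le_of_eq ?_) ((norm_sub_le _ _).trans (add_le_add h₁ h₂))
    congr 1
    push_cast
    ring
  have hlim := (intervalIntegral_tendsto_integral hi₂ tendsto_neg_atTop_atBot tendsto_id).sub
    (intervalIntegral_tendsto_integral hi₁ tendsto_neg_atTop_atBot tendsto_id)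
  have hzero := squeeze_zero_norm'
    ((eventually_ge_atTop (0 : ℝ)).mono fun T hT => key T hT) (by simpa using hg₀.mul_const θ)
  exact (sub_eq_zero.1 (tendsto_nhds_unique hlim hzero)).symm

theorem sq_div_four_le_cosh (u : ℝ) : u ^ 2 / 4 ≤ Real.cosh u := by
  have h := Real.quadratic_le_exp_of_nonneg (abs_nonneg u)
  rw [← Real.cosh_abs, Real.cosh_eq]
  have := Real.exp_pos (-|u|)
  have := abs_nonneg u
  rw [sq_abs] at h
  linarith

theorem norm_exp_neg_mul_cosh_add_mul_le {θ r y t u v : ℝ} (hθ : θ < Real.pi / 2) (hy : 0 < y)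
    (ht : 0 ≤ t) (hv₀ : 0 ≤ v) (hv : v ≤ θ) :
    ‖Complex.exp (-(y : ℂ) * Complex.cosh (u + v * Complex.I)
        + (r + t * Complex.I) * (u + v * Complex.I))‖ ≤
      Real.exp (2 * r ^ 2 / (y * Real.cos θ)) *
        Real.exp (-(y * Real.cos θ / 8) * u ^ 2) := by
  have hθ₀ : 0 ≤ θ := hv₀.trans hv
  have hc : 0 < y * Real.cos θ :=
    mul_pos hy (Real.cos_pos_of_mem_Ioo ⟨by linarith, hθ⟩)
  have hre : (-(y : ℂ) * Complex.cosh (u + v * Complex.I)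
      + (r + t * Complex.I) * (u + v * Complex.I)).re =
      -y * (Real.cosh u * Real.cos v) + (r * u - t * v) := by
    rw [Complex.cosh_add, Complex.cosh_mul_I, Complex.sinh_mul_I, ← Complex.ofReal_cosh,
      ← Complex.ofReal_sinh, ← Complex.ofReal_cos, ← Complex.ofReal_sin]
    simp [Complex.cos_ofReal_re]
  rw [Complex.norm_exp, hre, ← Real.exp_add, Real.exp_le_exp]
  have hcos : Real.cos θ ≤ Real.cos v :=
    Real.cos_le_cos_of_nonneg_of_le_pi hv₀ (by linarith [Real.pi_pos]) hv
  have h₁ : y * Real.cos θ * (u ^ 2 / 4) ≤ y * (Real.cosh u * Real.cos v) := by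
    calc y * Real.cos θ * (u ^ 2 / 4) ≤ y * Real.cos θ * Real.cosh u :=
          mul_le_mul_of_nonneg_left (sq_div_four_le_cosh u) hc.le
      _ = y * (Real.cosh u * Real.cos θ) := by ring
      _ ≤ _ := by gcongr
  have h₂ : 0 ≤ t * v := mul_nonneg ht hv₀
  set c := y * Real.cos θ
  have h₃ : 2 * r ^ 2 / c + c / 8 * u ^ 2 - r * u = (4 * r - c * u) ^ 2 / (8 * c) := by
    field_simp
    ring
  have h₄ : 0 ≤ (4 * r - c * u) ^ 2 / (8 * c) := by positivity
  linarith

theorem self_div_sinh_pos {u : ℝ} (hu : u ≠ 0) : 0 < u / Real.sinh u := by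
  rcases hu.lt_or_gt with h | h
  · exact div_pos_of_neg_of_neg h (Real.sinh_neg_iff.2 h)
  · exact div_pos h (Real.sinh_pos_iff.2 h)

theorem self_div_sinh_le_one (u : ℝ) : u / Real.sinh u ≤ 1 := by
  rcases lt_trichotomy u 0 with h | rfl | h
  · exact (div_le_one_of_neg (Real.sinh_neg_iff.2 h)).2 (Real.sinh_le_self_iff.2 h.le)
  · simp
  · exact (div_le_one (Real.sinh_pos_iff.2 h)).2 (Real.self_le_sinh_iff.2 h.le)

theorem abs_sinh_sub_self_mul_cosh_le (u : ℝ) :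
    |Real.sinh u - u * Real.cosh u| ≤ Real.sinh u ^ 2 := by
  wlog h : 0 ≤ u generalizing u
  · have := this (-u) (by linarith)
    rw [Real.sinh_neg, Real.cosh_neg, neg_sq] at this
    rwa [← abs_neg, show -(Real.sinh u - u * Real.cosh u) = -Real.sinh u - -u * Real.cosh u by ring]
  have h₁ := Real.self_le_sinh_iff.2 h
  have h₂ := Real.one_le_cosh u
  have h₃ : Real.cosh u - 1 ≤ Real.sinh u := by
    have := Real.cosh_sub_sinh u
    have := Real.exp_le_one_iff.2 (neg_nonpos.2 h)
    linarith
  have h₄ : Real.sinh u ≤ u * Real.cosh u := by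
    have hm : MonotoneOn (fun x => x * Real.cosh x - Real.sinh x) (Set.Ici 0) := by
      have hd : ∀ x : ℝ, HasDerivAt (fun x => x * Real.cosh x - Real.sinh x)
          (x * Real.sinh x) x := by
        intro x
        convert! ((hasDerivAt_id x).mul (Real.hasDerivAt_cosh x)).sub (Real.hasDerivAt_sinh x)
          using 1
        simp
      refine monotoneOn_of_deriv_nonneg (convex_Ici 0)
        (fun x _ => (hd x).continuousAt.continuousWithinAt)
        (fun x _ => (hd x).differentiableAt.differentiableWithinAt) fun x hx => ?_
      rw [interior_Ici] at hx
      rw [(hd x).deriv]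
      exact mul_nonneg (le_of_lt hx) (Real.sinh_nonneg_iff.2 (le_of_lt hx))
    simpa using hm Set.self_mem_Ici h h
  rw [abs_of_nonpos (by linarith)]
  nlinarith [mul_le_mul h₁ h₃ (by linarith) (h.trans h₁)]

theorem wSD_of_ne_zero (θ : ℝ) {u : ℝ} (hu : u ≠ 0) :
    wSD θ u = Real.arcsin (Real.sin θ * u / Real.sinh u) :=
  if_neg hu

theorem sin_mul_div_sinh_mem_Ioc {θ u : ℝ} (hθ₀ : 0 < θ) (hθ : θ < Real.pi / 2) (hu : u ≠ 0) :
    Real.sin θ * u / Real.sinh u ∈ Set.Ioc 0 (Real.sin θ) := by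
  have hs : 0 < Real.sin θ := Real.sin_pos_of_pos_of_lt_pi hθ₀ (by linarith)
  rw [mul_div_assoc]
  exact ⟨mul_pos hs (self_div_sinh_pos hu),
    mul_le_of_le_one_right hs.le (self_div_sinh_le_one u)⟩

theorem wSD_mem_Icc {θ : ℝ} (hθ₀ : 0 < θ) (hθ : θ < Real.pi / 2) (u : ℝ) :
    wSD θ u ∈ Set.Icc 0 θ := by
  by_cases hu : u = 0
  · simp [wSD, hu, hθ₀.le]
  · rw [wSD_of_ne_zero θ hu]
    have h := sin_mul_div_sinh_mem_Ioc hθ₀ hθ hu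
    refine ⟨Real.arcsin_nonneg.2 h.1.le, (Real.arcsin_le_arcsin h.2).trans_eq ?_⟩
    exact Real.arcsin_sin (by linarith) hθ.le

theorem hasDerivAt_wSD {θ u : ℝ} (hθ₀ : 0 < θ) (hθ : θ < Real.pi / 2) (hu : u ≠ 0) :
    HasDerivAt (wSD θ) (1 / √(1 - (Real.sin θ * u / Real.sinh u) ^ 2) *
      (Real.sin θ * (Real.sinh u - u * Real.cosh u) / Real.sinh u ^ 2)) u := by
  have h := sin_mul_div_sinh_mem_Ioc hθ₀ hθ hu
  have hs : Real.sin θ < 1 := by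
    simpa using Real.sin_lt_sin_of_lt_of_le_pi_div_two (by linarith) le_rfl hθ
  have h₁ : HasDerivAt (fun x => Real.sin θ * x / Real.sinh x)
      (Real.sin θ * (Real.sinh u - u * Real.cosh u) / Real.sinh u ^ 2) u := by
    convert! ((hasDerivAt_id u).const_mul (Real.sin θ)).div (Real.hasDerivAt_sinh u)
      (Real.sinh_ne_zero.2 hu) using 1
    simp only [id]
    ring
  have h₂ := (Real.hasDerivAt_arcsin (by linarith [h.1]) (by linarith [h.2])).comp u h₁
  refine h₂.congr_of_eventuallyEq ?_
  filter_upwards [isOpen_ne.mem_nhds hu] with x hx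
  exact wSD_of_ne_zero θ hx

theorem abs_deriv_wSD_le {θ u : ℝ} (hθ₀ : 0 < θ) (hθ : θ < Real.pi / 2) (hu : u ≠ 0) :
    |deriv (wSD θ) u| ≤ 1 / Real.cos θ * Real.sin θ := by
  have h := sin_mul_div_sinh_mem_Ioc hθ₀ hθ hu
  have hs : 0 < Real.sin θ := h.1.trans_le h.2
  have hc : 0 < Real.cos θ := Real.cos_pos_of_mem_Ioo ⟨by linarith, hθ⟩
  rw [(hasDerivAt_wSD hθ₀ hθ hu).deriv, abs_mul]
  refine mul_le_mul ?_ ?_ (abs_nonneg _) (by positivity)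
  · rw [abs_of_nonneg (by positivity)]
    refine one_div_le_one_div_of_le hc (Real.le_sqrt_of_sq_le ?_)
    have := pow_le_pow_left₀ h.1.le h.2 2
    linarith [Real.sin_sq_add_cos_sq θ]
  · have hsh : 0 < Real.sinh u ^ 2 := by
      have := Real.sinh_ne_zero.2 hu
      positivity
    rw [abs_div, abs_mul, abs_of_pos hs, abs_of_pos hsh, div_le_iff₀ hsh]
    exact mul_le_mul_of_nonneg_left (abs_sinh_sub_self_mul_cosh_le u) hs.le

theorem continuous_wSD {θ : ℝ} (hθ₀ : 0 < θ) (hθ : θ < Real.pi / 2) : Continuous (wSD θ) := by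
  refine continuous_iff_continuousAt.2 fun u => ?_
  by_cases hu : u = 0
  · subst hu
    rw [continuousAt_iff_punctured_nhds]
    have h₁ : Tendsto (fun x : ℝ => x / Real.sinh x) (𝓝[≠] 0) (𝓝 1) := by
      simpa [div_eq_mul_inv, mul_comm] using
        (Real.hasDerivAt_sinh 0).tendsto_slope_zero.inv₀ (by simp)
    have h₂ : Tendsto (fun x : ℝ => Real.arcsin (Real.sin θ * (x / Real.sinh x))) (𝓝[≠] 0)
        (𝓝 (wSD θ 0)) := by
      have h := (Real.continuous_arcsin.tendsto _).comp (h₁.const_mul (Real.sin θ))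
      rw [mul_one, Real.arcsin_sin (by linarith) hθ.le] at h
      simpa [wSD, Function.comp_def] using h
    refine h₂.congr' ?_
    filter_upwards [self_mem_nhdsWithin] with x hx
    rw [wSD_of_ne_zero θ hx, mul_div_assoc]
  · exact (hasDerivAt_wSD hθ₀ hθ hu).continuousAt

theorem sinh_mul_sin_wSD {θ : ℝ} (hθ₀ : 0 < θ) (hθ : θ < Real.pi / 2) (u : ℝ) :
    Real.sinh u * Real.sin (wSD θ u) = Real.sin θ * u := by
  by_cases hu : u = 0
  · simp [hu]
  · have h := sin_mul_div_sinh_mem_Ioc hθ₀ hθ hu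
    rw [wSD_of_ne_zero θ hu,
      Real.sin_arcsin (by linarith [h.1]) (h.2.trans (Real.sin_le_one θ))]
    field_simp [Real.sinh_ne_zero.2 hu]

theorem exponent_on_wSD {θ : ℝ} (hθ₀ : 0 < θ) (hθ : θ < Real.pi / 2) (r y u : ℝ) :
    -(y : ℂ) * Complex.cosh (u + wSD θ u * Complex.I)
        + (r + (y * Real.sin θ : ℝ) * Complex.I) * (u + wSD θ u * Complex.I) =
      -(y : ℂ) * ((Real.cosh u * Real.cos (wSD θ u) + wSD θ u * Real.sin θ : ℝ) : ℂ) +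
        r * u + Complex.I * r * (wSD θ u : ℝ) := by
  have h : Complex.sinh u * Complex.sin (wSD θ u) = Complex.sin θ * u := by
    exact_mod_cast congrArg ((↑) : ℝ → ℂ) (sinh_mul_sin_wSD hθ₀ hθ u)
  rw [Complex.cosh_add, Complex.cosh_mul_I, Complex.sinh_mul_I]
  push_cast
  linear_combination (-(y : ℂ) * Complex.I) * h +
    (y : ℂ) * Complex.sin θ * (wSD θ u : ℂ) * Complex.I_sq

theorem kbessel_steepest_descent_representation (θ r y : ℝ)
    (hθ0 : 0 < θ) (hθ : θ < Real.pi / 2) (hy : 0 < y) :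
    KBessel ((r : ℂ) + ((y * Real.sin θ : ℝ) : ℂ) * Complex.I) y =
      (1 / 2) * ∫ u : ℝ,
        Complex.exp (-(y : ℂ) *
            ((Real.cosh u * Real.cos (wSD θ u) + wSD θ u * Real.sin θ : ℝ) : ℂ)) *
          Complex.exp ((r : ℂ) * (u : ℂ)) *
          Complex.exp (Complex.I * (r : ℂ) * ((wSD θ u : ℝ) : ℂ)) *
          (1 + Complex.I * ((deriv (wSD θ) u : ℝ) : ℂ)) := by
  rw [KBessel]
  congr 1
  have hs : 0 < Real.sin θ := Real.sin_pos_of_pos_of_lt_pi hθ0 (by linarith)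
  have hb : 0 < y * Real.cos θ / 8 := by
    have : 0 < Real.cos θ := Real.cos_pos_of_mem_Ioo ⟨by linarith, hθ⟩
    positivity
  have hlim : Tendsto (fun T : ℝ => Real.exp (-(y * Real.cos θ / 8) * T ^ 2)) atTop (𝓝 0) :=
    Real.tendsto_exp_atBot.comp
      ((tendsto_pow_atTop two_ne_zero).const_mul_atTop_of_neg (neg_neg_of_pos hb))
  have h := integral_eq_integral_graph
    (f := fun z => Complex.exp (-(y : ℂ) * Complex.cosh z +
      (r + (y * Real.sin θ : ℝ) * Complex.I) * z))
    (g := fun u => Real.exp (2 * r ^ 2 / (y * Real.cos θ)) *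
      Real.exp (-(y * Real.cos θ / 8) * u ^ 2))
    (by fun_prop) (continuous_wSD hθ0 hθ) (fun u => (wSD_mem_Icc hθ0 hθ u).1)
    (fun u => (wSD_mem_Icc hθ0 hθ u).2)
    (fun u hu => (hasDerivAt_wSD hθ0 hθ hu).differentiableAt)
    (fun u hu => abs_deriv_wSD_le hθ0 hθ hu)
    ((integrable_exp_neg_mul_sq hb).const_mul _)
    (by simpa using (hlim.const_mul _).add (hlim.const_mul _))
    (fun u v hv₀ hv => norm_exp_neg_mul_cosh_add_mul_le hθ hy (mul_pos hy hs).le hv₀ hv)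
  simp only [exponent_on_wSD hθ0 hθ, Complex.exp_add] at h
  simpa only [Complex.ofReal_cosh, Complex.exp_add] using h
end
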